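/- Let k be a field of characteristic zero and V a k-vector space. On the tensor space T(V) = ⊕_{n≥0} V^{⊗n}, equipped with the shuffle product μ_sh and the deconcatenation coproduct Δ, the first eulerian idempotent e^{(1)} := log^⋆(id) = Σ_{n≥1} (−1)^{n+1} J^{⋆n}/n (where J = id − 1ε and ⋆ is the convolution product f⋆g = μ_sh ∘ (f⊗g) ∘ Δ) is a derivation for μ_sh along the map 1ε, i.e. e^{(1)} ∘ μ_sh = μ_sh ∘ (e^{(1)} ⊗ 1ε + 1ε ⊗ e^{(1)}). -/

import Mathlib

/-!
STATEMENT 0: On `T(V) = ⊕_{n≥0} V^{⊗n}` with the (signed) shuffle product `μ_sh` and the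
deconcatenation coproduct `Δ`, the first eulerian idempotent
`e^{(1)} = log^⋆(id) = Σ_{n≥1} (−1)^{n+1} J^{⋆n}/n` (`J = id − 1ε`, `⋆` the convolution
product) is a derivation for `μ_sh` along `1ε`:
`e^{(1)} ∘ μ_sh = μ_sh ∘ (e^{(1)} ⊗ 1ε + 1ε ⊗ e^{(1)})`.
-/

open TensorProduct DirectSum PiTensorProduct

noncomputable section

variable (k : Type) [Field k] [CharZero k] (V : Type) [AddCommGroup V] [Module k V]

/-- The `n`-th tensor power `V^{⊗n}`. -/
abbrev TPow (n : ℕ) : Type := ⨂[k] (_ : Fin n), V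

/-- The tensor module `T(V) = ⊕_{n≥0} V^{⊗n}`. -/
abbrev TMod : Type := ⨁ n : ℕ, TPow k V n

/-- Inclusion of the weight-`n` component. -/
abbrev incl (n : ℕ) : TPow k V n →ₗ[k] TMod k V := DirectSum.lof k ℕ (TPow k V) n

/-- `σ.(x₁ ⊗ … ⊗ xₙ) = x_{σ⁻¹(1)} ⊗ … ⊗ x_{σ⁻¹(n)}`. -/
def permAct {n : ℕ} (σ : Equiv.Perm (Fin n)) : TPow k V n →ₗ[k] TPow k V n :=
  (PiTensorProduct.reindex k (fun _ : Fin n => V) σ).toLinearMap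

/-- Concatenation `V^{⊗p} ⊗ V^{⊗q} → V^{⊗(p+q)}`. -/
def concat (p q : ℕ) : TPow k V p ⊗[k] TPow k V q →ₗ[k] TPow k V (p + q) :=
  (PiTensorProduct.reindex k (fun _ : Fin p ⊕ Fin q => V) finSumFinEquiv).toLinearMap ∘ₗ
    (PiTensorProduct.tmulEquiv (ι := Fin p) (ι₂ := Fin q) k V).toLinearMap

/-- `(p,q)`-shuffles: permutations of `Fin (p+q)` increasing on the first `p` and
on the last `q` entries. -/
def IsShuffle (p q : ℕ) (σ : Equiv.Perm (Fin (p + q))) : Prop :=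
  ∀ i j : Fin (p + q), i < j → ((j : ℕ) < p ∨ p ≤ (i : ℕ)) → σ i < σ j

/-- The finite set of `(p,q)`-shuffles. -/
def shuffles (p q : ℕ) : Finset (Equiv.Perm (Fin (p + q))) :=
  letI := Classical.decPred (IsShuffle p q)
  Finset.univ.filter (IsShuffle p q)

/-- The component `sh_{p,q}` of the (signed, graded) shuffle product. -/
def shMul (p q : ℕ) : TPow k V p ⊗[k] TPow k V q →ₗ[k] TPow k V (p + q) :=
  ∑ σ ∈ shuffles p q,
    (((Equiv.Perm.sign σ : ℤ) : k)) • (permAct k V σ ∘ₗ concat k V p q)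

/-- The shuffle product `μ_sh` as a bilinear map on `T(V)`. -/
def mulBil : TMod k V →ₗ[k] TMod k V →ₗ[k] TMod k V :=
  DirectSum.toModule k ℕ (TMod k V →ₗ[k] TMod k V) fun p =>
    ((DirectSum.toModule k ℕ (TPow k V p →ₗ[k] TMod k V) fun q =>
      (TensorProduct.curry (incl k V (p + q) ∘ₗ shMul k V p q)).flip)).flip

/-- The shuffle product `μ_sh : T(V) ⊗ T(V) → T(V)`. -/
def mulMap : TMod k V ⊗[k] TMod k V →ₗ[k] TMod k V := TensorProduct.lift (mulBil k V)

/-- Splitting `Fin n ≃ Fin p ⊕ Fin (n-p)` for `p ≤ n`. -/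
def splitEquiv (n : ℕ) (p : Fin (n + 1)) : Fin n ≃ (Fin (p : ℕ) ⊕ Fin (n - (p : ℕ))) :=
  (finCongr (Nat.add_sub_cancel' (Nat.lt_succ_iff.mp p.isLt)).symm).trans finSumFinEquiv.symm

/-- Weight-`n` component of the deconcatenation coproduct. -/
def comulComp (n : ℕ) : TPow k V n →ₗ[k] TMod k V ⊗[k] TMod k V :=
  ∑ p : Fin (n + 1),
    (TensorProduct.map (incl k V (p : ℕ)) (incl k V (n - (p : ℕ)))) ∘ₗ
      (PiTensorProduct.tmulEquiv (ι := Fin (p : ℕ)) (ι₂ := Fin (n - (p : ℕ))) k V).symm.toLinearMap ∘ₗ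
      (PiTensorProduct.reindex k (fun _ : Fin n => V) (splitEquiv n p)).toLinearMap

/-- The deconcatenation coproduct `Δ`. -/
def comul : TMod k V →ₗ[k] TMod k V ⊗[k] TMod k V :=
  DirectSum.toModule k ℕ (TMod k V ⊗[k] TMod k V) (comulComp k V)

/-- The counit `ε` : projection onto `V^{⊗0} = k`. -/
def counit : TMod k V →ₗ[k] k :=
  DirectSum.toModule k ℕ k fun n =>
    match n with
    | 0 => (PiTensorProduct.isEmptyEquiv (Fin 0)).toLinearMap
    | _ + 1 => 0

/-- The unit `1 ∈ V^{⊗0}`. -/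
def unitT : TMod k V := incl k V 0 ((PiTensorProduct.isEmptyEquiv (Fin 0)).symm 1)

/-- The map `1ε`, unit of the convolution algebra. -/
def oneEps : TMod k V →ₗ[k] TMod k V :=
  (LinearMap.toSpanSingleton k (TMod k V) (unitT k V)) ∘ₗ counit k V

/-- Convolution product `f ⋆ g = μ_sh ∘ (f ⊗ g) ∘ Δ`. -/
def conv (f g : TMod k V →ₗ[k] TMod k V) : TMod k V →ₗ[k] TMod k V :=
  mulMap k V ∘ₗ TensorProduct.map f g ∘ₗ comul k V

/-- Convolution powers `f^{⋆n}` (with `f^{⋆0} = 1ε`). -/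
def convPow (f : TMod k V →ₗ[k] TMod k V) : ℕ → (TMod k V →ₗ[k] TMod k V)
  | 0 => oneEps k V
  | n + 1 => conv k V f (convPow f n)

/-- `J = id - 1ε`. -/
def J : TMod k V →ₗ[k] TMod k V := LinearMap.id - oneEps k V

/-- The first eulerian idempotent `e^{(1)} = log^⋆(id) = Σ_{n≥1} (-1)^{n+1} J^{⋆n}/n`,
computed weight-wise (in weight `n` the series truncates at `n`). -/
def euler1 : TMod k V →ₗ[k] TMod k V :=
  DirectSum.toModule k ℕ (TMod k V) fun n =>
    ∑ m ∈ Finset.Icc 1 n,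
      ((-1 : k) ^ (m + 1) * (m : k)⁻¹) • (convPow k V (J k V) m ∘ₗ incl k V n)


set_option linter.unusedSectionVars false

/-- The word `x₁ ⊗ … ⊗ xₙ` attached to a list of vectors. -/
def word (l : List V) : TMod k V := incl k V l.length (tprod k l.get)

lemma word_ofFn {n : ℕ} (c : Fin n → V) : word k V (List.ofFn c) = incl k V n (tprod k c) := by
  have h : ∀ (m : ℕ) (hm : n = m) (d : Fin m → V), (∀ i, d i = c (Fin.cast hm.symm i)) →
      incl k V m (tprod k d) = incl k V n (tprod k c) := by
    rintro m rfl d hd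
    congr 2
    exact funext hd
  exact h _ (List.length_ofFn).symm _ fun i => by simp; rfl

lemma word_induction {P : TMod k V → Prop} (hw : ∀ l, P (word k V l))
    (hadd : ∀ u v, P u → P v → P (u + v)) (hsmul : ∀ (a : k) u, P u → P (a • u)) (u : TMod k V) :
    P u := by
  have h0 : P 0 := by simpa using hsmul 0 _ (hw [])
  induction u using DirectSum.induction_on with
  | zero => exact h0
  | of n x =>
    change P (incl k V n x)
    induction x using PiTensorProduct.induction_on with
    | smul_tprod r c =>
      rw [map_smul, ← word_ofFn]
      exact hsmul _ _ (hw _)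
    | add x y hx hy =>
      rw [map_add]
      exact hadd _ _ hx hy
  | add x y hx hy => exact hadd _ _ hx hy

variable {k V} in
lemma linearMap_ext_word {M : Type} [AddCommGroup M] [Module k M] {f g : TMod k V →ₗ[k] M}
    (h : ∀ l, f (word k V l) = g (word k V l)) : f = g :=
  LinearMap.ext <| word_induction k V h (fun u v hu hv => by rw [map_add, map_add, hu, hv])
    fun a u hu => by rw [map_smul, map_smul, hu]

/-- Left concatenation with a letter. -/
def consT (x : V) : TMod k V →ₗ[k] TMod k V :=
  DirectSum.toModule k ℕ (TMod k V) fun n =>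
    incl k V (n + 1) ∘ₗ PiTensorProduct.lift ((tprod k : MultilinearMap k (fun _ : Fin (n + 1) => V)
      (TPow k V (n + 1))).curryLeft x)

lemma consT_word (x : V) (l : List V) : consT k V x (word k V l) = word k V (x :: l) := by
  rw [word, consT, incl, DirectSum.toModule_lof]
  simp only [LinearMap.comp_apply, PiTensorProduct.lift.tprod, MultilinearMap.curryLeft_apply]
  rw [← word_ofFn]
  congr 1
  simp [List.ofFn_succ]

/-- The sign involution, acting by `(-1)ⁿ` in weight `n`. -/
def signT : TMod k V →ₗ[k] TMod k V :=
  DirectSum.toModule k ℕ (TMod k V) fun n => (-1 : k) ^ n • incl k V n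

lemma signT_word (l : List V) : signT k V (word k V l) = (-1 : k) ^ l.length • word k V l := by
  rw [word, signT, incl, DirectSum.toModule_lof]
  rfl

/-- Permutations of `Fin n` increasing on the first `p` entries and on the remaining ones. -/
def IsUnshuffled (p : ℕ) {n : ℕ} (σ : Equiv.Perm (Fin n)) : Prop :=
  ∀ i j : Fin n, i < j → ((j : ℕ) < p ∨ p ≤ (i : ℕ)) → σ i < σ j

lemma eq_one_of_strictMono {n : ℕ} {σ : Equiv.Perm (Fin n)} (h : StrictMono σ) : σ = 1 := by
  let e : Fin n ≃o Fin n := h.orderIsoOfSurjective σ σ.surjective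
  exact Equiv.ext fun i => DFunLike.congr_fun (Subsingleton.elim e (OrderIso.refl _)) i

/-- The permutation sending `i` to `0` and inducing `σ` on the other entries. -/
def consPerm {n : ℕ} (i : Fin (n + 1)) (σ : Equiv.Perm (Fin n)) : Equiv.Perm (Fin (n + 1)) :=
  Equiv.Perm.decomposeFin.symm (0, σ) * i.cycleRange

lemma consPerm_self {n : ℕ} (i : Fin (n + 1)) (σ : Equiv.Perm (Fin n)) : consPerm i σ i = 0 := by
  simp [consPerm]

lemma consPerm_succAbove {n : ℕ} (i : Fin (n + 1)) (σ : Equiv.Perm (Fin n)) (j : Fin n) :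
    consPerm i σ (i.succAbove j) = (σ j).succ := by
  simp [consPerm, Fin.cycleRange_succAbove]

lemma sign_consPerm {n : ℕ} (i : Fin (n + 1)) (σ : Equiv.Perm (Fin n)) :
    Equiv.Perm.sign (consPerm i σ) = (-1) ^ (i : ℕ) * Equiv.Perm.sign σ := by
  simp [consPerm, Fin.sign_cycleRange, mul_comm]

lemma consPerm_bijective (n : ℕ) :
    Function.Bijective fun a : Fin (n + 1) × Equiv.Perm (Fin n) => consPerm a.1 a.2 := by
  rw [Fintype.bijective_iff_injective_and_card]
  constructor
  · rintro ⟨i, σ⟩ ⟨j, τ⟩ h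
    have hij : i = j := by
      apply (consPerm i σ).injective
      rw [consPerm_self]
      simp only at h
      rw [h, consPerm_self]
    subst hij
    refine Prod.ext rfl (Equiv.ext fun a => Fin.succ_injective _ ?_)
    rw [← consPerm_succAbove i, ← consPerm_succAbove i]
    exact congrArg (· (i.succAbove a)) h
  · simp [Fintype.card_perm, Nat.factorial_succ]

lemma isUnshuffled_consPerm_zero {n : ℕ} (p : ℕ) (σ : Equiv.Perm (Fin n)) :
    IsUnshuffled (p + 1) (consPerm 0 σ) ↔ IsUnshuffled p σ := by
  constructor
  · intro h i j hij hp
    have := h (Fin.succAbove 0 i) (Fin.succAbove 0 j) (by simpa using hij) (by simp; omega)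
    rwa [consPerm_succAbove, consPerm_succAbove, Fin.succ_lt_succ_iff] at this
  · intro h i j hij hp
    obtain ⟨j, rfl⟩ := Fin.exists_succAbove_eq (x := j) (y := 0) (Fin.ne_zero_of_lt hij)
    rw [consPerm_succAbove]
    rcases eq_or_ne i 0 with rfl | hi
    · rw [consPerm_self]; exact Fin.succ_pos _
    obtain ⟨i, rfl⟩ := Fin.exists_succAbove_eq hi
    rw [consPerm_succAbove, Fin.succ_lt_succ_iff]
    simp at hij hp
    exact h i j hij hp

lemma isUnshuffled_consPerm_of_eq {n : ℕ} (p : ℕ) (i₀ : Fin (n + 1)) (hi₀ : (i₀ : ℕ) = p)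
    (σ : Equiv.Perm (Fin n)) : IsUnshuffled p (consPerm i₀ σ) ↔ IsUnshuffled p σ := by
  have hv : ∀ a : Fin n, ((i₀.succAbove a : Fin (n + 1)) : ℕ) = if (a : ℕ) < p then
      (a : ℕ) else a + 1 := by
    intro a
    simp only [Fin.succAbove, Fin.lt_def, Fin.val_castSucc, hi₀]
    split_ifs <;> simp
  constructor
  · intro h i j hij hp
    have := h (i₀.succAbove i) (i₀.succAbove j) (by simpa using hij)
      (by rw [hv, hv]; rw [Fin.lt_def] at hij; split_ifs <;> omega)
    rwa [consPerm_succAbove, consPerm_succAbove, Fin.succ_lt_succ_iff] at this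
  · intro h i j hij hp
    rcases eq_or_ne j i₀ with rfl | hj
    · rw [Fin.lt_def] at hij; omega
    obtain ⟨j, rfl⟩ := Fin.exists_succAbove_eq hj
    rw [consPerm_succAbove]
    rcases eq_or_ne i i₀ with rfl | hi
    · rw [consPerm_self]; exact Fin.succ_pos _
    obtain ⟨i, rfl⟩ := Fin.exists_succAbove_eq hi
    rw [consPerm_succAbove, Fin.succ_lt_succ_iff]
    rw [hv, hv] at hp
    have hij' : i < j := by simpa using hij
    rw [Fin.lt_def] at hij'
    refine h i j hij' ?_
    split_ifs at hp <;> omega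

lemma not_isUnshuffled_consPerm {n : ℕ} (p : ℕ) (i : Fin (n + 1)) (h0 : i ≠ 0)
    (hp : (i : ℕ) ≠ p) (σ : Equiv.Perm (Fin n)) : ¬ IsUnshuffled p (consPerm i σ) := by
  intro h
  have hi : 0 < (i : ℕ) := Nat.pos_of_ne_zero fun h => h0 (Fin.ext h)
  have hn : (i : ℕ) - 1 < n + 1 := by omega
  have := h ⟨i - 1, hn⟩ i (by rw [Fin.lt_def]; exact Nat.sub_lt hi one_pos) (by
    change (i : ℕ) < p ∨ p ≤ (i : ℕ) - 1
    omega)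
  rw [consPerm_self] at this
  exact absurd this (Fin.not_lt_zero _)

open Classical in
/-- The signed sum of the rearrangements of `c` by shuffles with first block of size `p`. -/
def shuffleSum (p : ℕ) {n : ℕ} (c : Fin n → V) : TMod k V :=
  ∑ σ : Equiv.Perm (Fin n), if IsUnshuffled p σ then
    ((Equiv.Perm.sign σ : ℤ) : k) • word k V (List.ofFn fun i => c (σ⁻¹ i)) else 0

lemma shuffleSum_of_le (p : ℕ) {n : ℕ} (c : Fin n → V) (h : p = 0 ∨ n ≤ p) :
    shuffleSum k V p c = word k V (List.ofFn c) := by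
  rw [shuffleSum, Fintype.sum_eq_single 1]
  · have h1 : IsUnshuffled p (1 : Equiv.Perm (Fin n)) := fun i j hij _ => hij
    simp [h1]
  · intro σ hσ
    refine if_neg fun hs => hσ (eq_one_of_strictMono fun i j hij => hs i j hij ?_)
    omega

lemma word_consPerm {n : ℕ} (c : Fin (n + 1) → V) (i : Fin (n + 1)) (σ : Equiv.Perm (Fin n)) :
    word k V (List.ofFn fun j => c ((consPerm i σ)⁻¹ j)) =
      consT k V (c i) (word k V (List.ofFn fun j => c (i.succAbove (σ⁻¹ j)))) := by
  rw [consT_word, List.ofFn_succ]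
  congr 3
  · rw [Equiv.Perm.inv_eq_iff_eq, consPerm_self]
  · funext j
    congr 1
    rw [Equiv.Perm.inv_eq_iff_eq, consPerm_succAbove]
    simp

lemma shuffleSum_succ (p : ℕ) {n : ℕ} (c : Fin (n + 1) → V) (i₀ : Fin (n + 1))
    (hi₀ : (i₀ : ℕ) = p + 1) :
    shuffleSum k V (p + 1) c =
      consT k V (c 0) (shuffleSum k V p fun j => c j.succ) +
        (-1 : k) ^ (p + 1) •
          consT k V (c i₀) (shuffleSum k V (p + 1) fun j => c (i₀.succAbove j)) := by
  classical
  conv_lhs => rw [shuffleSum]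
  rw [← (consPerm_bijective n).sum_comp, Fintype.sum_prod_type,
    Fintype.sum_eq_add 0 i₀ (fun h => by rw [← h] at hi₀; simp at hi₀)]
  · simp only [isUnshuffled_consPerm_zero, isUnshuffled_consPerm_of_eq _ _ hi₀, word_consPerm,
      sign_consPerm, shuffleSum, map_sum, apply_ite (consT k V _), map_zero, map_smul,
      Finset.smul_sum, smul_ite, smul_zero, smul_smul, Fin.succAbove_zero, hi₀]
    simp
  · rintro i ⟨h0, hi⟩
    refine Finset.sum_eq_zero fun σ _ => if_neg (not_isUnshuffled_consPerm _ _ h0 ?_ _)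
    exact fun h => hi (Fin.ext (h.trans hi₀.symm))

lemma mulBil_word_ofFn {p q : ℕ} (a : Fin p → V) (b : Fin q → V) :
    mulBil k V (word k V (List.ofFn a)) (word k V (List.ofFn b)) =
      shuffleSum k V p (Fin.append a b) := by
  classical
  rw [word_ofFn, word_ofFn, mulBil, incl, DirectSum.toModule_lof, LinearMap.flip_apply, incl,
    DirectSum.toModule_lof]
  simp only [LinearMap.flip_apply, TensorProduct.curry_apply, LinearMap.comp_apply, shMul,
    LinearMap.sum_apply, map_sum, LinearMap.smul_apply, map_smul]
  rw [shuffleSum, shuffles, Finset.sum_filter]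
  refine Finset.sum_congr rfl fun σ _ => ?_
  refine if_congr Iff.rfl ?_ rfl
  rw [word_ofFn]
  congr 2
  simp only [concat, permAct, LinearMap.comp_apply, LinearEquiv.coe_coe,
    PiTensorProduct.tmulEquiv_apply, PiTensorProduct.reindex_tprod]
  congr 1
  funext i
  change Sum.elim a b (finSumFinEquiv.symm (σ.symm i)) = Fin.append a b (σ.symm i)
  generalize σ.symm i = j
  refine Fin.addCases (fun j => ?_) (fun j => ?_) j <;> simp


variable {k V} in
lemma shuffleSum_eq_mulBil {n : ℕ} {c : Fin n → V} {l m : List V} (h : List.ofFn c = l ++ m) :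
    shuffleSum k V l.length c = mulBil k V (word k V l) (word k V m) := by
  obtain rfl : n = l.length + m.length := by simpa using congrArg List.length h
  have hc : c = Fin.append l.get m.get := by
    apply List.ofFn_injective
    rw [h, List.ofFn_fin_append, List.ofFn_get, List.ofFn_get]
  rw [hc, ← mulBil_word_ofFn, List.ofFn_get, List.ofFn_get]

lemma mulBil_nil_left (u : TMod k V) : mulBil k V (word k V []) u = u := by
  have h : mulBil k V (word k V []) = LinearMap.id := linearMap_ext_word fun l => by
    rw [← shuffleSum_eq_mulBil (c := l.get) (by simp), List.length_nil, shuffleSum_of_le _ _ _ _ (Or.inl rfl)]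
    simp
  exact LinearMap.congr_fun h u

lemma mulBil_nil_right (u : TMod k V) : mulBil k V u (word k V []) = u := by
  have h : (mulBil k V).flip (word k V []) = LinearMap.id := linearMap_ext_word fun l => by
    rw [LinearMap.flip_apply, ← shuffleSum_eq_mulBil (c := l.get) (by simp),
      shuffleSum_of_le _ _ _ _ (Or.inr le_rfl)]
    simp
  exact LinearMap.congr_fun h u

lemma mulBil_word_cons (x y : V) (l m : List V) :
    mulBil k V (word k V (x :: l)) (word k V (y :: m)) =
      consT k V x (mulBil k V (word k V l) (word k V (y :: m))) +
        (-1 : k) ^ (l.length + 1) •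
          consT k V y (mulBil k V (word k V (x :: l)) (word k V m)) := by
  let c : Fin (l.length + m.length + 1 + 1) → V :=
    fun i => (x :: l ++ y :: m)[(i : ℕ)]'(by have := i.2; simp; omega)
  let i₀ : Fin (l.length + m.length + 1 + 1) := ⟨l.length + 1, by omega⟩
  have hc : List.ofFn c = x :: l ++ y :: m := List.ext_getElem (by simp; omega) fun i h1 h2 => by
    simp only [List.getElem_ofFn, c, List.cons_append]
  have hs : List.ofFn (fun j => c j.succ) = l ++ y :: m :=
    List.ext_getElem (by simp; omega) fun i h1 h2 => by
    simp only [List.getElem_ofFn, c, Fin.val_succ, List.cons_append, List.getElem_cons_succ]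
  have ha : List.ofFn (fun j => c (i₀.succAbove j)) = x :: l ++ m := by
    refine List.ext_getElem (by simp) fun i h1 h2 => ?_
    simp only [List.getElem_ofFn, c, Fin.succAbove, Fin.lt_def, Fin.val_castSucc, i₀]
    by_cases hi : i < l.length + 1
    · simp only [hi, if_true, Fin.val_castSucc]
      rw [List.getElem_append_left (by simpa using hi), List.getElem_append_left (by simpa using hi)]
    · simp only [hi, if_false, Fin.val_succ]
      rw [List.getElem_append_right (by simp; omega), List.getElem_append_right (by simp; omega)]
      have : i + 1 - (x :: l).length = i - (x :: l).length + 1 := by simp; omega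
      simp only [this, List.getElem_cons_succ]
  rw [← shuffleSum_eq_mulBil hc, ← shuffleSum_eq_mulBil hs, ← shuffleSum_eq_mulBil ha,
    List.length_cons, shuffleSum_succ k V l.length c i₀ rfl]
  simp [c, i₀]

lemma mulBil_consT (x y : V) (u v : TMod k V) :
    mulBil k V (consT k V x u) (consT k V y v) =
      consT k V x (mulBil k V u (consT k V y v)) +
        (-1 : k) • consT k V y (mulBil k V (consT k V x (signT k V u)) v) := by
  induction u using word_induction with
  | hw l =>
    induction v using word_induction with
    | hw m =>
      rw [signT_word, map_smul, map_smul, LinearMap.smul_apply, map_smul]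
      simp only [consT_word, mulBil_word_cons, pow_succ', smul_smul]
    | hadd u v hu hv => simp only [map_add, hu, hv, smul_add]; abel
    | hsmul a u hu => simp only [map_smul, hu, smul_add, smul_comm a]
  | hadd u v hu hv => simp only [map_add, LinearMap.add_apply, hu, hv, smul_add]; abel
  | hsmul a u hu => simp only [map_smul, LinearMap.smul_apply, hu, smul_add, smul_comm a]

/-- The weight-`n` component of `T(V)`. -/
def weight (n : ℕ) : Submodule k (TMod k V) := LinearMap.range (incl k V n)

lemma word_mem_weight (l : List V) : word k V l ∈ weight k V l.length := ⟨_, rfl⟩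

variable {k V} in
lemma weight_induction {n : ℕ} {P : ∀ u : TMod k V, u ∈ weight k V n → Prop}
    (hw : ∀ l (hl : l.length = n), P (word k V l) (hl ▸ word_mem_weight k V l))
    (hadd : ∀ u v hu hv, P u hu → P v hv → P (u + v) (add_mem hu hv))
    (hsmul : ∀ (a : k) u hu, P u hu → P (a • u) (Submodule.smul_mem _ a hu))
    {u : TMod k V} (hu : u ∈ weight k V n) : P u hu := by
  obtain ⟨x, rfl⟩ := hu
  induction x using PiTensorProduct.induction_on with
  | smul_tprod r c =>
    simp only [map_smul, ← word_ofFn]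
    exact hsmul _ _ _ (hw _ (by simp))
  | add x y hx hy =>
    simp only [map_add]
    exact hadd _ _ _ _ hx hy

lemma shuffleSum_mem_weight (p : ℕ) {n : ℕ} (c : Fin n → V) :
    shuffleSum k V p c ∈ weight k V n := by
  refine Submodule.sum_mem _ fun σ _ => ?_
  split_ifs
  · rw [word_ofFn]
    exact Submodule.smul_mem _ _ ⟨_, rfl⟩
  · exact Submodule.zero_mem _

variable {k V} in
lemma mulBil_mem_weight {p q : ℕ} {u v : TMod k V} (hu : u ∈ weight k V p)
    (hv : v ∈ weight k V q) : mulBil k V u v ∈ weight k V (p + q) := by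
  induction hu using weight_induction with
  | hw l hl =>
    induction hv using weight_induction with
    | hw m hm =>
      subst hl hm
      rw [← List.ofFn_get l, ← List.ofFn_get m, mulBil_word_ofFn]
      simpa using shuffleSum_mem_weight k V l.length (Fin.append l.get m.get)
    | hadd u v _ _ hu hv => rw [map_add]; exact add_mem hu hv
    | hsmul a u _ hu => rw [map_smul]; exact Submodule.smul_mem _ _ hu
  | hadd u v _ _ hu hv => rw [map_add]; exact add_mem hu hv
  | hsmul a u _ hu => rw [map_smul]; exact Submodule.smul_mem _ _ hu

variable {k V} in
lemma signT_of_mem_weight {n : ℕ} {u : TMod k V} (hu : u ∈ weight k V n) :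
    signT k V u = (-1 : k) ^ n • u := by
  induction hu using weight_induction with
  | hw l hl => rw [signT_word, hl]
  | hadd u v _ _ hu hv => rw [map_add, hu, hv, smul_add]
  | hsmul a u _ hu => rw [map_smul, hu, smul_comm]

lemma mulBil_word_comm (l m : List V) : mulBil k V (word k V l) (word k V m) =
    (-1 : k) ^ (l.length * m.length) • mulBil k V (word k V m) (word k V l) := by
  match l, m with
  | [], m => simp [mulBil_nil_left, mulBil_nil_right]
  | l, [] => simp [mulBil_nil_left, mulBil_nil_right]
  | x :: l, y :: m =>
    rw [mulBil_word_cons, mulBil_word_cons, mulBil_word_comm l (y :: m),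
      mulBil_word_comm (x :: l) m, add_comm]
    simp only [map_smul, smul_add, smul_smul, ← pow_add, List.length_cons]
    have h (a b : ℕ) (hab : Even (a + b)) : (-1 : k) ^ a = (-1) ^ b :=
      neg_one_pow_congr (Nat.even_add.mp hab)
    congr 2
    · exact h _ _ ⟨l.length * m.length + l.length + m.length + 1, by ring⟩
    · exact h _ _ ⟨l.length * m.length + l.length + m.length + 1, by ring⟩
  termination_by l.length + m.length

variable {k V} in
lemma mulBil_comm {p q : ℕ} {u v : TMod k V} (hu : u ∈ weight k V p) (hv : v ∈ weight k V q) :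
    mulBil k V u v = (-1 : k) ^ (p * q) • mulBil k V v u := by
  induction hu using weight_induction with
  | hw l hl =>
    induction hv using weight_induction with
    | hw m hm => rw [mulBil_word_comm, hl, hm]
    | hadd u v _ _ hu hv => simp only [map_add, LinearMap.add_apply, hu, hv, smul_add]
    | hsmul a u _ hu => rw [map_smul, hu, map_smul, LinearMap.smul_apply, smul_comm]
  | hadd u v _ _ hu hv => simp only [map_add, LinearMap.add_apply, hu, hv, smul_add]
  | hsmul a u _ hu => rw [map_smul, LinearMap.smul_apply, hu, map_smul, smul_comm]

lemma mulBil_word_assoc (l m n : List V) :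
    mulBil k V (mulBil k V (word k V l) (word k V m)) (word k V n) =
      mulBil k V (word k V l) (mulBil k V (word k V m) (word k V n)) := by
  match l, m, n with
  | [], m, n => simp [mulBil_nil_left]
  | l, [], n => simp [mulBil_nil_left, mulBil_nil_right]
  | l, m, [] => simp [mulBil_nil_right]
  | x :: l, y :: m, z :: n =>
    have h1 := mulBil_word_assoc l (y :: m) (z :: n)
    have h2 := mulBil_word_assoc (x :: l) m (z :: n)
    have h3 := mulBil_word_assoc (x :: l) (y :: m) n
    have hA := signT_of_mem_weight
      (mulBil_mem_weight (word_mem_weight k V l) (word_mem_weight k V (y :: m)))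
    have hB := signT_of_mem_weight
      (mulBil_mem_weight (word_mem_weight k V (x :: l)) (word_mem_weight k V m))
    rw [mulBil_word_cons] at h3 ⊢
    rw [mulBil_word_cons k V y z] at h1 ⊢
    simp only [← consT_word, map_add, map_smul, LinearMap.add_apply, LinearMap.smul_apply,
      mulBil_consT, signT_word] at h1 h2 h3 hA hB ⊢
    rw [hA, hB, h1, h2, ← h3]
    simp only [map_add, map_smul, LinearMap.smul_apply, List.length_cons]
    rw [show l.length + 1 + m.length = l.length + (m.length + 1) by ring]
    match_scalars <;> ring
  termination_by l.length + m.length + n.length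

lemma mulBil_assoc (u v w : TMod k V) :
    mulBil k V (mulBil k V u v) w = mulBil k V u (mulBil k V v w) := by
  induction u using word_induction with
  | hw l =>
    induction v using word_induction with
    | hw m =>
      induction w using word_induction with
      | hw n => exact mulBil_word_assoc k V l m n
      | hadd u v hu hv => simp only [map_add, hu, hv]
      | hsmul a u hu => simp only [map_smul, hu]
    | hadd u v hu hv => simp only [map_add, LinearMap.add_apply, hu, hv]
    | hsmul a u hu => simp only [map_smul, LinearMap.smul_apply, hu]
  | hadd u v hu hv => simp only [map_add, LinearMap.add_apply, hu, hv]
  | hsmul a u hu => simp only [map_smul, LinearMap.smul_apply, hu]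

lemma comul_word (l : List V) : comul k V (word k V l) =
    ∑ i ∈ Finset.range (l.length + 1), word k V (l.take i) ⊗ₜ[k] word k V (l.drop i) := by
  rw [word, comul, incl, DirectSum.toModule_lof, comulComp, LinearMap.sum_apply,
    Finset.sum_range]
  refine Finset.sum_congr rfl fun p _ => ?_
  simp only [LinearMap.comp_apply, LinearEquiv.coe_coe, PiTensorProduct.reindex_tprod,
    PiTensorProduct.tmulEquiv_symm_apply, TensorProduct.map_tmul, ← word_ofFn]
  have hp := p.2
  congr 2
  · refine List.ext_getElem (by simp; omega) fun i h1 h2 => ?_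
    simp [splitEquiv]
  · refine List.ext_getElem (by simp) fun i h1 h2 => ?_
    simp [splitEquiv]

lemma comul_consT (x : V) (u : TMod k V) : comul k V (consT k V x u) =
    word k V [] ⊗ₜ[k] consT k V x u + (consT k V x).rTensor _ (comul k V u) := by
  induction u using word_induction with
  | hw l =>
    rw [consT_word, comul_word, comul_word, List.length_cons, Finset.sum_range_succ', add_comm,
      map_sum]
    simp [consT_word]
  | hadd u v hu hv => simp only [map_add, hu, hv, TensorProduct.tmul_add]; abel
  | hsmul a u hu => simp only [map_smul, hu, TensorProduct.tmul_smul, smul_add]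

lemma comul_mulBil (l m : List V) : comul k V (mulBil k V (word k V l) (word k V m)) =
    ∑ i ∈ Finset.range (l.length + 1), ∑ j ∈ Finset.range (m.length + 1),
      (-1 : k) ^ ((l.length - i) * j) •
        (mulBil k V (word k V (l.take i)) (word k V (m.take j)) ⊗ₜ[k]
          mulBil k V (word k V (l.drop i)) (word k V (m.drop j))) := by
  match l, m with
  | [], m => simp [mulBil_nil_left, comul_word]
  | l, [] => simp [mulBil_nil_right, comul_word]
  | x :: l, y :: m =>
    rw [mulBil_word_cons, map_add, map_smul, comul_consT, comul_consT, comul_mulBil l (y :: m),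
      comul_mulBil (x :: l) m]
    simp only [List.length_cons, Finset.sum_range_succ' _ (_ + 1), Finset.sum_add_distrib,
      List.take_succ_cons, List.drop_succ_cons, List.take_zero, List.drop_zero, map_add, map_sum,
      map_smul, LinearMap.rTensor_tmul, mulBil_nil_left, mulBil_nil_right, mulBil_word_cons,
      consT_word, Nat.add_sub_add_right, mul_zero, pow_zero, one_smul, TensorProduct.tmul_add,
      TensorProduct.add_tmul, smul_add, TensorProduct.tmul_smul, Nat.sub_zero, Finset.smul_sum]
    have hsign (F : ℕ → ℕ → TMod k V ⊗[k] TMod k V) :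
        ∑ i ∈ Finset.range (l.length + 1), ∑ j ∈ Finset.range (m.length + 1),
          (-1 : k) ^ (l.length + 1) • (-1 : k) ^ ((l.length - i) * j) • F i j =
        ∑ i ∈ Finset.range (l.length + 1), ∑ j ∈ Finset.range (m.length + 1),
          (-1 : k) ^ ((l.length - i) * (j + 1)) • (-1 : k) ^ ((l.take i).length + 1) • F i j := by
      refine Finset.sum_congr rfl fun i hi => Finset.sum_congr rfl fun j _ => ?_
      obtain ⟨d, hd⟩ := Nat.exists_eq_add_of_le (Finset.mem_range_succ_iff.mp hi)
      rw [smul_smul, smul_smul, List.length_take_of_le (by omega), hd, Nat.add_sub_cancel_left]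
      congr 1
      ring
    have hsign' (F : ℕ → TMod k V ⊗[k] TMod k V) :
        ∑ j ∈ Finset.range (m.length + 1),
          (-1 : k) ^ (l.length + 1) • (-1 : k) ^ ((l.length + 1) * j) • F j =
        ∑ j ∈ Finset.range (m.length + 1), (-1 : k) ^ ((l.length + 1) * (j + 1)) • F j := by
      refine Finset.sum_congr rfl fun j _ => ?_
      rw [smul_smul]
      congr 1
      ring
    simp only [← TensorProduct.smul_tmul', hsign, hsign']
    abel
  termination_by l.length + m.length

lemma counit_word_nil : counit k V (word k V []) = 1 := by
  rw [word, counit, incl, DirectSum.toModule_lof]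
  simp

lemma counit_word_cons (x : V) (l : List V) : counit k V (word k V (x :: l)) = 0 := by
  rw [word, counit, incl, DirectSum.toModule_lof]
  rfl

lemma unitT_eq_word : unitT k V = word k V [] := by
  rw [unitT, word]
  congr 1
  rw [LinearEquiv.symm_apply_eq]
  simp

lemma oneEps_word_nil : oneEps k V (word k V []) = word k V [] := by
  simp [oneEps, counit_word_nil, unitT_eq_word]

lemma oneEps_word_cons (x : V) (l : List V) : oneEps k V (word k V (x :: l)) = 0 := by
  simp [oneEps, counit_word_cons]

lemma oneEps_consT (x : V) (u : TMod k V) : oneEps k V (consT k V x u) = 0 := by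
  have h : oneEps k V ∘ₗ consT k V x = 0 := linearMap_ext_word fun l => by
    simp [consT_word, oneEps_word_cons]
  exact LinearMap.congr_fun h u

lemma oneEps_mulBil_word (l m : List V) : oneEps k V (mulBil k V (word k V l) (word k V m)) =
    mulBil k V (oneEps k V (word k V l)) (oneEps k V (word k V m)) := by
  match l, m with
  | [], m => simp [mulBil_nil_left, oneEps_word_nil]
  | l, [] => simp [mulBil_nil_right, oneEps_word_nil]
  | x :: l, y :: m => simp [mulBil_word_cons, oneEps_word_cons, oneEps_consT]

lemma conv_word (f g : TMod k V →ₗ[k] TMod k V) (l : List V) : conv k V f g (word k V l) =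
    ∑ i ∈ Finset.range (l.length + 1),
      mulBil k V (f (word k V (l.take i))) (g (word k V (l.drop i))) := by
  simp [conv, comul_word, mulMap]

lemma conv_oneEps_left (f : TMod k V →ₗ[k] TMod k V) : conv k V (oneEps k V) f = f := by
  refine linearMap_ext_word fun l => ?_
  rw [conv_word, Finset.sum_range_succ']
  rw [Finset.sum_eq_zero, zero_add]
  · simp [oneEps_word_nil, mulBil_nil_left]
  · intro i hi
    match l with
    | [] => simp at hi
    | x :: l => simp [oneEps_word_cons]

variable {k V} in
lemma convPow_id_mem_weight (r : ℕ) {n : ℕ} {u : TMod k V} (hu : u ∈ weight k V n) :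
    convPow k V LinearMap.id r u ∈ weight k V n := by
  induction r generalizing n u with
  | zero =>
    induction hu using weight_induction with
    | hw l hl =>
      match l with
      | [] => rw [convPow, oneEps_word_nil, ← hl]; exact word_mem_weight k V []
      | x :: l => rw [convPow, oneEps_word_cons]; exact zero_mem _
    | hadd u v _ _ hu hv => rw [map_add]; exact add_mem hu hv
    | hsmul a u _ hu => rw [map_smul]; exact Submodule.smul_mem _ _ hu
  | succ r ih =>
    induction hu using weight_induction with
    | hw l hl =>
      rw [convPow, conv_word]
      refine Submodule.sum_mem _ fun i hi => ?_
      have := mulBil_mem_weight (word_mem_weight k V (l.take i)) (ih (word_mem_weight k V (l.drop i)))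
      rwa [← List.length_append, List.take_append_drop, hl] at this
    | hadd u v _ _ hu hv => rw [map_add]; exact add_mem hu hv
    | hsmul a u _ hu => rw [map_smul]; exact Submodule.smul_mem _ _ hu

lemma convPow_id_mulBil_word (r : ℕ) (l m : List V) :
    convPow k V LinearMap.id r (mulBil k V (word k V l) (word k V m)) =
      mulBil k V (convPow k V LinearMap.id r (word k V l))
        (convPow k V LinearMap.id r (word k V m)) := by
  induction r generalizing l m with
  | zero => exact oneEps_mulBil_word k V l m
  | succ r ih =>
    rw [convPow, conv_word, conv_word, conv]
    simp only [LinearMap.comp_apply, comul_mulBil, map_sum, map_smul, TensorProduct.map_tmul,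
      LinearMap.id_apply, mulMap, TensorProduct.lift.tmul, ih, LinearMap.sum_apply]
    rw [Finset.sum_comm]
    refine Finset.sum_congr rfl fun j hj => Finset.sum_congr rfl fun i hi => ?_
    have hm := word_mem_weight k V (m.take j)
    have hl := convPow_id_mem_weight r (word_mem_weight k V (l.drop i))
    rw [List.length_take_of_le (by simpa [Nat.lt_succ_iff] using hj)] at hm
    rw [List.length_drop] at hl
    rw [mulBil_assoc, mulBil_assoc, ← mulBil_assoc k V (word k V (m.take j)), mulBil_comm hm hl,
      map_smul, LinearMap.smul_apply, map_smul, smul_smul, mul_comm j, ← pow_add,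
      Even.neg_one_pow ⟨_, rfl⟩, one_smul, mulBil_assoc]

lemma convPow_J_eq_zero (m : ℕ) (l : List V) (h : l.length < m) :
    convPow k V (J k V) m (word k V l) = 0 := by
  induction m generalizing l with
  | zero => simp at h
  | succ m ih =>
    rw [convPow, conv_word, Finset.sum_range_succ']
    rw [Finset.sum_eq_zero, zero_add]
    · simp [J, oneEps_word_nil]
    · intro i hi
      rw [Finset.mem_range] at hi
      rw [ih _ (by rw [List.length_drop]; omega), map_zero]

/-- Left convolution by `f`, as an endomorphism. -/
def convLeft (f : TMod k V →ₗ[k] TMod k V) : Module.End k (TMod k V →ₗ[k] TMod k V) where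
  toFun g := conv k V f g
  map_add' g h := by simp [conv, TensorProduct.map_add_right, LinearMap.add_comp, LinearMap.comp_add]
  map_smul' a g := by
    simp [conv, TensorProduct.map_smul_right, LinearMap.smul_comp, LinearMap.comp_smul]

lemma convPow_eq_convLeft_pow (f : TMod k V →ₗ[k] TMod k V) (r : ℕ) :
    convPow k V f r = (convLeft k V f ^ r) (oneEps k V) := by
  induction r with
  | zero => rfl
  | succ r ih => rw [convPow, ih, pow_succ', Module.End.mul_apply]; rfl

lemma convLeft_id : convLeft k V LinearMap.id = convLeft k V (J k V) + 1 := by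
  refine LinearMap.ext fun f => ?_
  have h : (LinearMap.id : TMod k V →ₗ[k] TMod k V) = J k V + oneEps k V :=
    LinearMap.ext fun u => (sub_add_cancel u (oneEps k V u)).symm
  change conv k V LinearMap.id f = conv k V (J k V) f + f
  conv_rhs => enter [2]; rw [← conv_oneEps_left k V f]
  rw [h]
  simp only [conv, TensorProduct.map_add_left, LinearMap.add_comp, LinearMap.comp_add]

lemma convPow_id_word (r N : ℕ) (l : List V) (hl : l.length ≤ N) :
    convPow k V LinearMap.id r (word k V l) =
      ∑ m ∈ Finset.range (N + 1), (r.choose m : k) • convPow k V (J k V) m (word k V l) := by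
  have h : convPow k V LinearMap.id r (word k V l) =
      ∑ m ∈ Finset.range (r + 1), (r.choose m : k) • convPow k V (J k V) m (word k V l) := by
    rw [convPow_eq_convLeft_pow, convLeft_id, (Commute.one_right _).add_pow, LinearMap.sum_apply,
      LinearMap.sum_apply]
    refine Finset.sum_congr rfl fun m _ => ?_
    rw [one_pow, mul_one, ← nsmul_eq_mul', LinearMap.smul_apply, LinearMap.smul_apply,
      ← convPow_eq_convLeft_pow, Nat.cast_smul_eq_nsmul]
  rw [h, Finset.sum_subset (Finset.range_subset_range.mpr (le_max_left (r + 1) (N + 1))),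
    Finset.sum_subset (Finset.range_subset_range.mpr (le_max_right (r + 1) (N + 1)))]
  · intro m _ hm
    rw [convPow_J_eq_zero, smul_zero]
    simp at hm; omega
  · intro m _ hm
    rw [Nat.choose_eq_zero_of_lt (by simpa [Nat.lt_succ_iff] using hm), Nat.cast_zero, zero_smul]

lemma euler1_word (N : ℕ) (l : List V) (hl : l.length ≤ N) : euler1 k V (word k V l) =
    ∑ m ∈ Finset.range (N + 1),
      ((-1 : k) ^ (m + 1) * (m : k)⁻¹) • convPow k V (J k V) m (word k V l) := by
  conv_lhs => rw [word, euler1, incl, DirectSum.toModule_lof]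
  rw [LinearMap.sum_apply]
  refine Finset.sum_subset_zero_on_sdiff (fun m hm => ?_) (fun m hm => ?_) fun m _ => rfl
  · simp at hm ⊢; omega
  · rcases Nat.eq_zero_or_pos m with rfl | h0
    · simp
    · rw [convPow_J_eq_zero, smul_zero]
      simp at hm; omega

variable {k V} in
lemma convPow_id_of_mem_weight (r : ℕ) {n : ℕ} {u : TMod k V} (hu : u ∈ weight k V n) :
    convPow k V LinearMap.id r u =
      ∑ m ∈ Finset.range (n + 1), (r.choose m : k) • convPow k V (J k V) m u := by
  induction hu using weight_induction with
  | hw l hl => exact convPow_id_word k V r n l hl.le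
  | hadd u v _ _ hu hv => simp only [map_add, hu, hv, smul_add, Finset.sum_add_distrib]
  | hsmul a u _ hu => simp only [map_smul, hu, Finset.smul_sum, smul_comm a]

variable {k V} in
lemma euler1_of_mem_weight {n : ℕ} {u : TMod k V} (hu : u ∈ weight k V n) : euler1 k V u =
    ∑ m ∈ Finset.range (n + 1),
      ((-1 : k) ^ (m + 1) * (m : k)⁻¹) • convPow k V (J k V) m u := by
  induction hu using weight_induction with
  | hw l hl => exact euler1_word k V n l hl.le
  | hadd u v _ _ hu hv => simp only [map_add, hu, hv, smul_add, Finset.sum_add_distrib]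
  | hsmul a u _ hu => simp only [map_smul, hu, Finset.smul_sum, smul_comm a]

open Polynomial in
/-- The binomial coefficient `X choose m` as a polynomial. -/
def choosePoly (m : ℕ) : k[X] := C ((m.factorial : k)⁻¹) * descPochhammer k m

lemma eval_choosePoly (m r : ℕ) : (choosePoly k m).eval (r : k) = r.choose m := by
  have h : (m.factorial : k) ≠ 0 := Nat.cast_ne_zero.mpr m.factorial_ne_zero
  rw [choosePoly, Polynomial.eval_C_mul, descPochhammer_eval_eq_descFactorial,
    Nat.descFactorial_eq_factorial_mul_choose, Nat.cast_mul, inv_mul_cancel_left₀ h]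

lemma coeff_zero_choosePoly (m : ℕ) : (choosePoly k m).coeff 0 = if m = 0 then 1 else 0 := by
  rw [Polynomial.coeff_zero_eq_eval_zero, ← Nat.cast_zero, eval_choosePoly]
  cases m <;> simp

lemma coeff_one_descPochhammer (m : ℕ) :
    (descPochhammer k (m + 1)).coeff 1 = (-1) ^ m * (m.factorial : k) := by
  induction m with
  | zero => simp
  | succ m ih =>
    rw [descPochhammer_succ_right, mul_sub, Polynomial.coeff_sub, Polynomial.coeff_mul_X,
      ← Polynomial.C_eq_natCast, Polynomial.coeff_mul_C, ih, Polynomial.coeff_zero_eq_eval_zero,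
      descPochhammer_eval_zero]
    simp [Nat.factorial_succ, pow_succ]
    ring

lemma coeff_one_choosePoly (m : ℕ) :
    (choosePoly k m).coeff 1 = (-1) ^ (m + 1) * (m : k)⁻¹ := by
  rw [choosePoly, Polynomial.coeff_C_mul]
  cases m with
  | zero => simp [Polynomial.coeff_one]
  | succ m =>
    have h : (m.factorial : k) ≠ 0 := Nat.cast_ne_zero.mpr m.factorial_ne_zero
    have h' : (m : k) + 1 ≠ 0 := Nat.cast_add_one_ne_zero m
    rw [coeff_one_descPochhammer, Nat.factorial_succ]
    push_cast
    field_simp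
    ring

lemma euler1_mulBil_word (l m : List V) : euler1 k V (mulBil k V (word k V l) (word k V m)) =
    mulBil k V (euler1 k V (word k V l)) (oneEps k V (word k V m)) +
      mulBil k V (oneEps k V (word k V l)) (euler1 k V (word k V m)) := by
  rw [← sub_eq_zero, ← Module.forall_dual_apply_eq_zero_iff k]
  intro φ
  rw [map_sub, sub_eq_zero]
  have huv := mulBil_mem_weight (word_mem_weight k V l) (word_mem_weight k V m)
  have hpoly : ∑ n ∈ Finset.range (l.length + m.length + 1),
        Polynomial.C (φ (convPow k V (J k V) n (mulBil k V (word k V l) (word k V m)))) *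
          choosePoly k n =
      ∑ i ∈ Finset.range (l.length + 1), ∑ j ∈ Finset.range (m.length + 1),
        Polynomial.C (φ (mulBil k V (convPow k V (J k V) i (word k V l))
          (convPow k V (J k V) j (word k V m)))) * (choosePoly k i * choosePoly k j) := by
    refine Polynomial.eq_of_infinite_eval_eq _ _ <|
      (Set.infinite_range_of_injective (Nat.cast_injective (R := k))).mono ?_
    rintro _ ⟨r, rfl⟩
    have h := congrArg φ (convPow_id_mulBil_word k V r l m)
    rw [convPow_id_of_mem_weight r huv, convPow_id_word k V r _ l le_rfl,
      convPow_id_word k V r _ m le_rfl] at h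
    simp only [map_sum, map_smul, LinearMap.sum_apply, LinearMap.smul_apply, smul_eq_mul] at h
    simp only [Finset.mul_sum] at h
    rw [Finset.sum_comm] at h
    simp only [Set.mem_ofPred_eq, Polynomial.eval_finsetSum, Polynomial.eval_mul,
      Polynomial.eval_C, eval_choosePoly]
    convert h using 1
    · exact Finset.sum_congr rfl fun _ _ => mul_comm _ _
    · exact Finset.sum_congr rfl fun _ _ => Finset.sum_congr rfl fun _ _ => by ring
  have h := congrArg (Polynomial.coeff · 1) hpoly
  simp only [Polynomial.finsetSum_coeff, Polynomial.coeff_C_mul] at h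
  simp only [Polynomial.mul_coeff_one,
    coeff_zero_choosePoly, coeff_one_choosePoly] at h
  rw [euler1_of_mem_weight huv, euler1_word k V _ l le_rfl, euler1_word k V _ m le_rfl]
  simp only [map_add, map_sum, map_smul, LinearMap.sum_apply, LinearMap.smul_apply, smul_eq_mul]
  simp only [mul_add, Finset.sum_add_distrib, ite_mul, mul_ite, mul_one, mul_zero, one_mul,
    zero_mul, Finset.sum_ite_eq', Finset.sum_ite_irrel, Finset.sum_const_zero] at h
  simp only [Finset.mem_range, Nat.succ_pos, if_true, mul_comm (φ _)] at h
  rw [h, add_comm]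
  rfl

theorem euler1_is_derivation_along_oneEps :
    euler1 k V ∘ₗ mulMap k V =
      mulMap k V ∘ₗ
        (TensorProduct.map (euler1 k V) (oneEps k V)
          + TensorProduct.map (oneEps k V) (euler1 k V)) := by
  refine TensorProduct.ext (linearMap_ext_word fun l => linearMap_ext_word fun m => ?_)
  simpa [mulMap] using euler1_mulBil_word k V l m

end
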